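/- Fix 0 < x₀ ≤ d < u and let g_{du}(α) := [u^α(1 − α·log(x₀/d)) − d^α(1 − α·log(x₀/u))] / (α(u^α − d^α)). Then lim_{α → 0+} g_{du}(α) = [(log u)² − (log d)² − 2·log(u)·log(x₀/d) + 2·log(d)·log(x₀/u)] / (2·log(u/d)), and lim_{α → ∞} g_{du}(α) = −log(x₀/d) = log(d/x₀). -/

import Mathlib

open Real Filter

lemma aux_one (k : ℝ) : Tendsto (fun x : ℝ => (Real.exp (k * x) - 1) / x)
    (nhdsWithin 0 (Set.Ioi 0)) (nhds k) := by
  have h : HasDerivAt (fun x : ℝ => Real.exp (k * x)) k 0 := by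
    have := ((hasDerivAt_id (0:ℝ)).const_mul k).exp
    simpa using this
  have h2 := h.tendsto_slope.mono_left
    (nhdsWithin_mono 0 (fun x (hx : x ∈ Set.Ioi (0:ℝ)) => ne_of_gt hx))
  refine h2.congr fun x => ?_
  simp [slope_def_field]

lemma aux_two (k : ℝ) : Tendsto (fun x : ℝ => (Real.exp (k * x) - 1 - k * x) / x ^ 2)
    (nhdsWithin 0 (Set.Ioi 0)) (nhds (k ^ 2 / 2)) := by
  refine HasDerivAt.lhopital_zero_nhdsGT (f' := fun x => k * Real.exp (k * x) - k)
    (g' := fun x => 2 * x) ?_ ?_ ?_ ?_ ?_ ?_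
  · refine Eventually.of_forall fun x => ?_
    have h0 : HasDerivAt (fun y : ℝ => k * y) k x := by
      simpa using (hasDerivAt_id x).const_mul k
    have h1 := (h0.exp.sub_const 1).sub h0
    rw [mul_comm (Real.exp (k * x)) k] at h1
    exact h1
  · refine Eventually.of_forall fun x => ?_
    simpa using hasDerivAt_pow 2 x
  · filter_upwards [self_mem_nhdsWithin] with x hx
    have : (0:ℝ) < x := hx
    positivity
  · have : Continuous (fun x : ℝ => Real.exp (k * x) - 1 - k * x) := by fun_prop
    have := this.tendsto 0
    simp at this
    exact this.mono_left nhdsWithin_le_nhds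
  · have : Continuous (fun x : ℝ => x ^ 2) := by fun_prop
    have := this.tendsto 0
    simp at this
    exact this.mono_left nhdsWithin_le_nhds
  · have := (aux_one k).const_mul (k / 2)
    rw [show k ^ 2 / 2 = k / 2 * k by ring]
    refine this.congr' ?_
    filter_upwards [self_mem_nhdsWithin] with x hx
    have : x ≠ 0 := ne_of_gt hx
    field_simp

/-- Limits of the Pareto I truncated moment function g_{du} as α → 0+ and α → ∞. -/
theorem stmt_12 (x₀ d u : ℝ) (hx₀ : 0 < x₀) (hxd : x₀ ≤ d) (hdu : d < u)
    (g : ℝ → ℝ)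
    (hg : ∀ α : ℝ, g α =
      (u ^ α * (1 - α * Real.log (x₀ / d)) - d ^ α * (1 - α * Real.log (x₀ / u))) /
        (α * (u ^ α - d ^ α))) :
    Filter.Tendsto g (nhdsWithin 0 (Set.Ioi 0))
      (nhds (((Real.log u) ^ 2 - (Real.log d) ^ 2
        - 2 * Real.log u * Real.log (x₀ / d)
        + 2 * Real.log d * Real.log (x₀ / u)) / (2 * Real.log (u / d)))) ∧
    Filter.Tendsto g Filter.atTop (nhds (-Real.log (x₀ / d))) := by
  have hd : 0 < d := hx₀.trans_le hxd
  have hu : 0 < u := hd.trans hdu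
  have hab : Real.log d < Real.log u := Real.log_lt_log hd hdu
  rw [Real.log_div hx₀.ne' hd.ne', Real.log_div hx₀.ne' hu.ne', Real.log_div hu.ne' hd.ne']
  have hg' : g = fun α => (Real.exp (Real.log u * α) * (1 - α * (Real.log x₀ - Real.log d))
      - Real.exp (Real.log d * α) * (1 - α * (Real.log x₀ - Real.log u))) /
        (α * (Real.exp (Real.log u * α) - Real.exp (Real.log d * α))) := by
    funext α
    rw [hg, Real.log_div hx₀.ne' hd.ne', Real.log_div hx₀.ne' hu.ne',
      Real.rpow_def_of_pos hu, Real.rpow_def_of_pos hd]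
  rw [hg']
  generalize Real.log u = b at *
  generalize Real.log d = a at *
  generalize Real.log x₀ = c at *
  have hba : b - a ≠ 0 := (sub_pos.2 hab).ne'
  constructor
  · have hN := (((aux_two b).sub (aux_two a)).sub ((aux_one b).const_mul (c - a))).add
      ((aux_one a).const_mul (c - b))
    have hD := (aux_one b).sub (aux_one a)
    have h := hN.div hD hba
    have e : (b ^ 2 - a ^ 2 - 2 * b * (c - a) + 2 * a * (c - b)) / (2 * (b - a)) =
        (b ^ 2 / 2 - a ^ 2 / 2 - (c - a) * b + (c - b) * a) / (b - a) := by
      field_simp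
    rw [e]
    refine h.congr' ?_
    filter_upwards [self_mem_nhdsWithin] with x hx
    have hx0 : (0:ℝ) < x := hx
    have hne : Real.exp (b * x) - Real.exp (a * x) ≠ 0 := by
      have : Real.exp (a * x) < Real.exp (b * x) :=
        Real.exp_lt_exp.2 (mul_lt_mul_of_pos_right hab hx0)
      exact (sub_pos.2 this).ne'
    simp only [Pi.div_apply]
    generalize Real.exp (b * x) = B at *
    generalize Real.exp (a * x) = A at *
    have e2 : (B - 1) / x - (A - 1) / x = (B - A) / x := by ring
    rw [e2]
    field_simp
    ring
  · have hr : Tendsto (fun x : ℝ => Real.exp (-((b - a) * x))) atTop (nhds 0) :=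
      Real.tendsto_exp_neg_atTop_nhds_zero.comp
        (tendsto_id.const_mul_atTop (sub_pos.2 hab))
    have hi : Tendsto (fun x : ℝ => x⁻¹) atTop (nhds 0) := tendsto_inv_atTop_zero
    have h := ((hi.sub_const (c - a)).sub (hr.mul (hi.sub_const (c - b)))).div
      (hr.const_sub 1) (by norm_num)
    have e : (0 - (c - a) - 0 * (0 - (c - b))) / (1 - 0) = -(c - a) := by ring
    rw [e] at h
    refine h.congr' ?_
    filter_upwards [eventually_gt_atTop 0] with x hx0
    have hlt : Real.exp (a * x) < Real.exp (b * x) :=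
      Real.exp_lt_exp.2 (mul_lt_mul_of_pos_right hab hx0)
    have hB := Real.exp_pos (b * x)
    have er : Real.exp (-((b - a) * x)) = Real.exp (a * x) / Real.exp (b * x) := by
      rw [← Real.exp_sub]; ring_nf
    simp only [Pi.div_apply]
    rw [er]
    generalize Real.exp (b * x) = B at *
    generalize Real.exp (a * x) = A at *
    have hne : B - A ≠ 0 := (sub_pos.2 hlt).ne'
    have e2 : 1 - A / B = (B - A) / B := by field_simp
    rw [e2]
    field_simp
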